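/- Let G be a minimal counterexample. Then G contains no 4-vertex in U that is incident to three 2-threads and to a 1-thread whose bordering vertex other than v lies in F ∪ U. -/

import Mathlib

open SimpleGraph

noncomputable def edgeCount {V : Type*} (G : SimpleGraph V) : ℕ := Nat.card G.edgeSet

noncomputable def deg {V : Type*} (G : SimpleGraph V) (v : V) : ℕ := Nat.card (G.neighborSet v)

def TwoIndependent {V : Type*} (G : SimpleGraph V) (S : Set V) : Prop :=
  ∀ u ∈ S, ∀ v ∈ S, u ≠ v → ¬ G.Adj u v ∧ ∀ w, ¬ (G.Adj u w ∧ G.Adj w v)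

def IsIFPartition {V : Type*} (G : SimpleGraph V) (A B : Set V) : Prop :=
  A ∪ B = Set.univ ∧ Disjoint A B ∧ TwoIndependent G A ∧ (G.induce B).IsAcyclic

def IsAssignment {V : Type*} (I F U : Set V) : Prop :=
  I ∪ F ∪ U = Set.univ ∧ Disjoint I F ∧ Disjoint I U ∧ Disjoint F U

noncomputable def rho {V : Type*} (G : SimpleGraph V) (I F U : Set V) (H : G.Subgraph) : ℤ :=
  (H.verts ∩ I).ncard + 4 * (H.verts ∩ F).ncard + 5 * (H.verts ∩ U).ncard
    - 4 * Nat.card H.edgeSet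

noncomputable def rhoSet {V : Type*} (G : SimpleGraph V) (I F U : Set V) (S : Set V) : ℤ :=
  (S ∩ I).ncard + 4 * (S ∩ F).ncard + 5 * (S ∩ U).ncard - 4 * edgeCount (G.induce S)

def IsCounterexample {V : Type*} [Fintype V] (G : SimpleGraph V) (I F U : Set V) : Prop :=
  IsAssignment I F U ∧
  (∀ H : G.Subgraph, H.verts.Nonempty → 0 < rho G I F U H) ∧
  ¬ ∃ A B : Set V, IsIFPartition G A B ∧ I ⊆ A ∧ F ⊆ B

def IsMinCounterexample {V : Type*} [Fintype V] (G : SimpleGraph V) (I F U : Set V) : Prop :=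
  IsCounterexample G I F U ∧
  ∀ (n : ℕ) (G' : SimpleGraph (Fin n)) (I' F' U' : Set (Fin n)),
    IsCounterexample G' I' F' U' →
    Fintype.card V + edgeCount G ≤ n + edgeCount G'

def IsThread {V : Type*} (G : SimpleGraph V) (I F U : Set V) (p : List V) : Prop :=
  p ≠ [] ∧ p.Nodup ∧ p.Chain' G.Adj ∧ (∀ v ∈ p, v ∈ U ∧ deg G v = 2) ∧
  (∀ w, w ∉ p → (∃ a ∈ p, G.Adj a w) → 3 ≤ deg G w ∨ w ∈ I ∪ F)

def BordersThread {V : Type*} (G : SimpleGraph V) (p : List V) (w : V) : Prop :=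
  w ∉ p ∧ ∃ a ∈ p, G.Adj a w

def IsStarForest {V : Type*} (H : SimpleGraph V) : Prop :=
  H.IsAcyclic ∧ ∀ a b c d : V, H.Adj a b → H.Adj b c → H.Adj c d → a = c ∨ b = d

def IsStarColoring {V : Type*} {k : ℕ} (G : SimpleGraph V) (c : V → Fin k) : Prop :=
  (∀ u v, G.Adj u v → c u ≠ c v) ∧
  ∀ i j : Fin k, IsStarForest (G.induce {v | c v = i ∨ c v = j})

def StarColorable {V : Type*} (G : SimpleGraph V) (k : ℕ) : Prop :=
  ∃ c : V → Fin k, IsStarColoring G c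

def MadLt {V : Type*} (G : SimpleGraph V) (q : ℚ) : Prop :=
  ∀ H : G.Subgraph, H.verts.Nonempty →
    (2 * (Nat.card H.edgeSet : ℚ)) / (H.verts.ncard : ℚ) < q

open Classical in
/-- Number of ordered adjacent pairs between two finsets. -/
noncomputable def E2 {W : Type*} (G : SimpleGraph W) (X Y : Finset W) : ℤ :=
  ∑ x ∈ X, ∑ y ∈ Y, if G.Adj x y then 1 else 0

open Classical in
/-- Weight of a vertex. -/
noncomputable def wt {W : Type*} (I F : Set W) (x : W) : ℤ :=
  if x ∈ I then 1 else if x ∈ F then 4 else 5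

/-- Potential of the subgraph induced by a finset. -/
noncomputable def pot {W : Type*} (G : SimpleGraph W) (I F : Set W) (X : Finset W) : ℤ :=
  ∑ x ∈ X, wt I F x - 2 * E2 G X X

lemma E2_nonneg {W : Type*} (G : SimpleGraph W) (X Y : Finset W) : 0 ≤ E2 G X Y := by
  unfold E2
  exact Finset.sum_nonneg fun x _ => Finset.sum_nonneg fun y _ => by split_ifs <;> norm_num

lemma E2_comm {W : Type*} (G : SimpleGraph W) (X Y : Finset W) : E2 G X Y = E2 G Y X := by
  unfold E2
  rw [Finset.sum_comm]
  refine Finset.sum_congr rfl fun x _ => Finset.sum_congr rfl fun y _ => ?_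
  have := G.adj_comm x y
  split_ifs <;> simp_all

lemma E2_union_left {W : Type*} [DecidableEq W] (G : SimpleGraph W) {X Y : Finset W}
    (h : Disjoint X Y) (Z : Finset W) : E2 G (X ∪ Y) Z = E2 G X Z + E2 G Y Z := by
  unfold E2
  rw [Finset.sum_union h]

lemma E2_union_right {W : Type*} [DecidableEq W] (G : SimpleGraph W) {X Y : Finset W}
    (h : Disjoint X Y) (Z : Finset W) : E2 G Z (X ∪ Y) = E2 G Z X + E2 G Z Y := by
  rw [E2_comm, E2_union_left G h, E2_comm G X, E2_comm G Y]

lemma E2_union {W : Type*} [DecidableEq W] (G : SimpleGraph W) {X Y : Finset W}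
    (h : Disjoint X Y) :
    E2 G (X ∪ Y) (X ∪ Y) = E2 G X X + 2 * E2 G X Y + E2 G Y Y := by
  rw [E2_union_left G h, E2_union_right G h, E2_union_right G h, E2_comm G Y X]; ring

lemma E2_self_singleton {W : Type*} (G : SimpleGraph W) (x : W) : E2 G {x} {x} = 0 := by
  simp [E2]

lemma E2_map {W W' : Type*} (G : SimpleGraph W) (f : W' ↪ W) (X Y : Finset W') :
    E2 (G.comap f) X Y = E2 G (X.map f) (Y.map f) := by
  unfold E2
  rw [Finset.sum_map]
  refine Finset.sum_congr rfl fun x _ => ?_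
  rw [Finset.sum_map]
  rfl

lemma two_edgeCount {W : Type*} [Fintype W] (G : SimpleGraph W) :
    2 * (edgeCount G : ℤ) = E2 G Finset.univ Finset.univ := by
  classical
  have h := G.sum_degrees_eq_twice_card_edges
  have h2 : edgeCount G = G.edgeFinset.card := by
    rw [edgeCount, Nat.card_eq_fintype_card, edgeFinset_card]
  rw [h2]
  have h3 : (2 * (G.edgeFinset.card : ℤ)) = ((∑ v, G.degree v : ℕ) : ℤ) := by rw [h]; push_cast; ring
  rw [h3]
  push_cast
  unfold E2
  refine Finset.sum_congr rfl fun x _ => ?_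
  rw [← card_neighborFinset_eq_degree, neighborFinset_eq_filter]
  rw [Finset.sum_ite]
  simp

lemma E2_le_of_le {W : Type*} [Fintype W] (G H : SimpleGraph W) (X : Finset W) (hle : H ≤ G)
    (hX : ∀ x y, H.Adj x y → x ∈ X) : E2 H Finset.univ Finset.univ ≤ E2 G X X := by
  classical
  have : E2 H Finset.univ Finset.univ = E2 H X X := by
    unfold E2
    rw [← Finset.sum_subset (Finset.subset_univ X)]
    · refine Finset.sum_congr rfl fun x _ => ?_
      rw [← Finset.sum_subset (Finset.subset_univ X)]
      intro y _ hy
      rw [if_neg]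
      intro h; exact hy (hX _ _ h.symm)
    · intro x _ hx
      refine Finset.sum_eq_zero fun y _ => ?_
      rw [if_neg]
      intro h; exact hx (hX _ _ h)
  rw [this]
  unfold E2
  refine Finset.sum_le_sum fun x _ => Finset.sum_le_sum fun y _ => ?_
  by_cases h : H.Adj x y
  · simp [h, hle h]
  · simp only [h, if_false]; split_ifs <;> norm_num

lemma sum_wt {W : Type*} [Fintype W] (I F U : Set W) (h : IsAssignment I F U) (X : Finset W) :
    (((X : Set W) ∩ I).ncard : ℤ) + 4 * ((X : Set W) ∩ F).ncard + 5 * ((X : Set W) ∩ U).ncard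
      = ∑ x ∈ X, wt I F x := by
  classical
  obtain ⟨h1, h2, h3, h4⟩ := h
  have key : ∀ J : Set W, (((X : Set W) ∩ J).ncard : ℤ) = ∑ x ∈ X, if x ∈ J then 1 else 0 := by
    intro J
    have : (X : Set W) ∩ J = ((X.filter (· ∈ J) : Finset W) : Set W) := by ext; simp
    rw [this, Set.ncard_coe_finset]; simp
  rw [key, key, key, Finset.mul_sum, Finset.mul_sum, ← Finset.sum_add_distrib,
    ← Finset.sum_add_distrib]
  refine Finset.sum_congr rfl fun x _ => ?_
  have hx : x ∈ I ∪ F ∪ U := by rw [h1]; trivial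
  rw [Set.disjoint_left] at h2 h3 h4
  have a := @h2 x; have b := @h3 x; have c := @h4 x
  simp only [Set.mem_union] at hx
  unfold wt
  by_cases i : x ∈ I <;> by_cases f : x ∈ F <;> by_cases u : x ∈ U <;> simp_all

lemma edgeSet_card {W : Type*} (G : SimpleGraph W) (H : G.Subgraph) :
    Nat.card H.edgeSet = edgeCount H.spanningCoe := by
  unfold edgeCount
  rw [Subgraph.edgeSet_spanningCoe]

lemma rho_ge {W : Type*} [Fintype W] (G : SimpleGraph W) (I F U : Set W)
    (h : IsAssignment I F U) (H : G.Subgraph) (X : Finset W) (hX : (X : Set W) = H.verts) :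
    pot G I F X ≤ rho G I F U H := by
  unfold rho pot
  rw [edgeSet_card, ← hX, sum_wt I F U h]
  have := two_edgeCount H.spanningCoe
  have h2 := E2_le_of_le G H.spanningCoe X H.spanningCoe_le (by
    intro x y hxy
    have : x ∈ H.verts := H.edge_vert hxy
    rw [← hX] at this; exact this)
  linarith

lemma pot_pos {W : Type*} [Fintype W] {G : SimpleGraph W} {I F U : Set W}
    (h : IsCounterexample G I F U) (X : Finset W) (hX : X.Nonempty) : 0 < pot G I F X := by
  classical
  have h1 := h.2.1 ((⊤ : G.Subgraph).induce X) (by simpa using hX)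
  unfold rho at h1
  rw [edgeSet_card] at h1
  have h2 := two_edgeCount ((⊤ : G.Subgraph).induce (X : Set W)).spanningCoe
  have h3 : E2 G X X ≤ E2 ((⊤ : G.Subgraph).induce (X : Set W)).spanningCoe
      Finset.univ Finset.univ := by
    refine le_trans (b := E2 ((⊤ : G.Subgraph).induce (X : Set W)).spanningCoe X X) ?_ ?_
    · unfold E2
      refine Finset.sum_le_sum fun x hx => Finset.sum_le_sum fun y hy => ?_
      simp [hx, hy]
    · unfold E2
      refine le_trans (Finset.sum_le_sum_of_subset_of_nonneg (Finset.subset_univ X) ?_) ?_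
      · intro x _ _
        exact Finset.sum_nonneg fun y _ => by split_ifs <;> norm_num
      · refine Finset.sum_le_sum fun x _ => ?_
        refine Finset.sum_le_sum_of_subset_of_nonneg (Finset.subset_univ X) ?_
        intro y _ _
        split_ifs <;> norm_num
  rw [Subgraph.induce_verts, sum_wt I F U h.1] at h1
  unfold pot
  linarith

lemma acyclic_bound {W : Type*} [Fintype W] [Nonempty W] (G : SimpleGraph W) (h : G.IsAcyclic) :
    E2 G Finset.univ Finset.univ < 2 * Fintype.card W := by
  classical
  obtain ⟨T, hT, -, hT2⟩ := (connected_top (V := W)).exists_isTree_le_of_le_of_isAcyclic le_top h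
  have h1 := hT2.card_edgeFinset
  have h2 : G.edgeFinset.card ≤ T.edgeFinset.card := Finset.card_mono (by simpa using hT)
  rw [← two_edgeCount]
  have h3 : edgeCount G = G.edgeFinset.card := by
    rw [edgeCount, Nat.card_eq_fintype_card, edgeFinset_card]
  rw [h3]; omega

lemma acyclic_of_bound {W : Type*} [Fintype W] (G : SimpleGraph W)
    (h : ∀ X : Finset W, X.Nonempty → E2 G X X < 2 * X.card) : G.IsAcyclic := by
  classical
  intro u c hc
  have := h c.support.toFinset ⟨u, by simp⟩
  apply absurd this
  push Not
  have : (2 * c.support.toFinset.card : ℤ) = ∑ x ∈ c.support.toFinset, 2 := by simp; ring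
  rw [this]
  unfold E2
  refine Finset.sum_le_sum fun x hx => ?_
  have h2 := hc.ncard_neighborSet_toSubgraph_eq_two (v := x) (by simpa using hx)
  rw [Finset.sum_boole]
  norm_cast
  rw [← h2]
  rw [← Set.ncard_coe_finset]
  refine Set.ncard_le_ncard ?_ (Set.toFinite _)
  intro y hy
  rw [Subgraph.mem_neighborSet] at hy
  have h4 := hy.snd_mem
  have h5 := hy.adj_sub
  simp only [Walk.mem_verts_toSubgraph] at h4
  simp [h4, h5]

lemma induce_acyclic_iff {W : Type*} [Fintype W] (G : SimpleGraph W) (B : Set W) :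
    (G.induce B).IsAcyclic ↔
      ∀ X : Finset W, (X : Set W) ⊆ B → X.Nonempty → E2 G X X < 2 * X.card := by
  classical
  constructor
  · intro h X hX hne
    have : (G.induce (X : Set W)).IsAcyclic :=
      h.embedding (SimpleGraph.induceHomOfLE G hX)
    have hne' : Nonempty (X : Set W) := hne.to_subtype
    have h2 := acyclic_bound _ this
    have h3 := E2_map G (Function.Embedding.subtype (· ∈ (X : Set W))) Finset.univ Finset.univ
    have h4 : (Finset.univ : Finset (X : Set W)).map
        (Function.Embedding.subtype (· ∈ (X : Set W))) = X := by ext; simp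
    rw [h4] at h3
    rw [← h3]
    have h5 : Fintype.card (X : Set W) = X.card := by simp
    rw [h5] at h2
    exact h2
  · intro h
    apply acyclic_of_bound
    intro X hX
    have h3 := E2_map G (Function.Embedding.subtype (· ∈ B)) X X
    have h4 := h (X.map (Function.Embedding.subtype (· ∈ B))) (by intro x; simp; tauto) (by simpa using hX)
    rw [← h3, Finset.card_map] at h4
    exact h4

/-- Partition of the subgraph induced by a finset `S`. -/
def GoodPart {W : Type*} (G : SimpleGraph W) (I F : Set W) (S A B : Finset W) : Prop :=
  (∀ x, x ∈ S ↔ (x ∈ A ∨ x ∈ B)) ∧ (∀ x ∈ A, x ∉ B) ∧ (∀ x ∈ S, x ∈ I → x ∈ A) ∧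
  (∀ x ∈ S, x ∈ F → x ∈ B) ∧
  (∀ u ∈ A, ∀ v ∈ A, u ≠ v → ¬ G.Adj u v ∧ ∀ w ∈ S, ¬ (G.Adj u w ∧ G.Adj w v)) ∧
  (∀ X : Finset W, X ⊆ B → X.Nonempty → E2 G X X < 2 * X.card)

lemma no_good {V : Type*} [Fintype V] {G : SimpleGraph V} {I F U : Set V}
    (h : IsCounterexample G I F U) (A B : Finset V) : ¬ GoodPart G I F Finset.univ A B := by
  rintro ⟨h1, h2, h3, h4, h5, h6⟩
  refine h.2.2 ⟨A, B, ⟨?_, ?_, ?_, ?_⟩, ?_, ?_⟩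
  · ext x; simpa using h1 x
  · rw [Set.disjoint_left]; intro x hx; simpa using h2 x (by simpa using hx)
  · intro u hu v hv huv
    have := h5 u (by simpa using hu) v (by simpa using hv) huv
    exact ⟨this.1, fun w => this.2 w (Finset.mem_univ w)⟩
  · rw [induce_acyclic_iff]
    intro X hX; exact h6 X (by simpa using hX)
  · intro x hx; simpa using h3 x (Finset.mem_univ x) hx
  · intro x hx; simpa using h4 x (Finset.mem_univ x) hx

lemma exists_good {V : Type*} [Fintype V] {G : SimpleGraph V} {I F U : Set V}
    (h : IsMinCounterexample G I F U) {W : Type*} [Fintype W] (K : SimpleGraph W) (J L : Set W)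
    (hJL : Disjoint J L) (S : Finset W)
    (hpos : ∀ X ⊆ S, X.Nonempty → 0 < pot K J L X)
    (hlt : 2 * (S.card : ℤ) + E2 K S S <
      2 * Fintype.card V + E2 G Finset.univ Finset.univ) :
    ∃ A B : Finset W, GoodPart K J L S A B := by
  classical
  let f : Fin S.card ↪ W := S.equivFin.symm.toEmbedding.trans (Function.Embedding.subtype _)
  have hfS : ∀ i, f i ∈ S := fun i => (S.equivFin.symm i).2
  have hSf : ∀ x ∈ S, ∃ i, f i = x := fun x hx => ⟨S.equivFin ⟨x, hx⟩, by simp [f]⟩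
  have hmap : (Finset.univ : Finset (Fin S.card)).map f = S := by
    ext x; simp only [Finset.mem_map, Finset.mem_univ, true_and]
    exact ⟨by rintro ⟨i, rfl⟩; exact hfS i, hSf x⟩
  have hnc : ¬ IsCounterexample (K.comap f) (f ⁻¹' J) (f ⁻¹' L) (f ⁻¹' (J ∪ L)ᶜ) := by
    intro hc
    have h1 := h.2 _ _ _ _ _ hc
    have h2 := two_edgeCount (K.comap f)
    have h3 := two_edgeCount G
    rw [E2_map, hmap] at h2
    push_cast [← @Nat.cast_le ℤ] at h1
    linarith
  have hass : IsAssignment (f ⁻¹' J) (f ⁻¹' L) (f ⁻¹' (J ∪ L)ᶜ) := by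
    refine ⟨?_, ?_, ?_, ?_⟩
    · ext x; simp; tauto
    · exact hJL.preimage f
    · rw [Set.disjoint_left]; intro x; simp; tauto
    · rw [Set.disjoint_left]; intro x; simp; tauto
  have hp : ∀ H : (K.comap f).Subgraph, H.verts.Nonempty →
      0 < rho (K.comap f) (f ⁻¹' J) (f ⁻¹' L) (f ⁻¹' (J ∪ L)ᶜ) H := by
    intro H hH
    refine lt_of_lt_of_le ?_ (rho_ge _ _ _ _ hass H H.verts.toFinset (by simp))
    have h1 := hpos (H.verts.toFinset.map f) (by
      intro x hx; simp only [Finset.mem_map] at hx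
      obtain ⟨i, -, rfl⟩ := hx; exact hfS i) (by simpa using hH)
    unfold pot at h1 ⊢
    rw [E2_map]
    rw [Finset.sum_map] at h1
    exact h1
  have hex : ∃ A B : Set (Fin S.card), IsIFPartition (K.comap f) A B ∧ f ⁻¹' J ⊆ A ∧
      f ⁻¹' L ⊆ B := by
    by_contra hcon
    exact hnc ⟨hass, hp, hcon⟩
  obtain ⟨A, B, ⟨hU, hD, hT, hAc⟩, hA, hB⟩ := hex
  rw [induce_acyclic_iff] at hAc
  rw [Set.disjoint_left] at hD
  refine ⟨A.toFinset.map f, B.toFinset.map f, ?_, ?_, ?_, ?_, ?_, ?_⟩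
  · intro x
    constructor
    · intro hx
      obtain ⟨i, rfl⟩ := hSf x hx
      have : i ∈ A ∪ B := by rw [hU]; trivial
      simpa using this
    · simp only [Finset.mem_map]
      rintro (⟨i, -, rfl⟩ | ⟨i, -, rfl⟩) <;> exact hfS i
  · intro x
    simp only [Finset.mem_map, Set.mem_toFinset]
    rintro ⟨i, hi, rfl⟩ ⟨j, hj, hij⟩
    rw [f.injective hij] at hj
    exact hD hi hj
  · intro x hx hxJ
    obtain ⟨i, rfl⟩ := hSf x hx
    simpa using hA hxJ
  · intro x hx hxJ
    obtain ⟨i, rfl⟩ := hSf x hx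
    simpa using hB hxJ
  · intro u hu v hv huv
    simp only [Finset.mem_map, Set.mem_toFinset] at hu hv
    obtain ⟨i, hi, rfl⟩ := hu
    obtain ⟨j, hj, rfl⟩ := hv
    have := hT i hi j hj (by rintro rfl; exact huv rfl)
    refine ⟨this.1, fun w hw => ?_⟩
    obtain ⟨k, rfl⟩ := hSf w hw
    exact this.2 k
  · intro X hX hne
    obtain ⟨Y, hY, rfl⟩ := Finset.subset_map_iff.1 hX
    have := hAc Y (by intro y hy; simpa using hY hy) (by simpa using hne)
    rw [E2_map] at this
    simpa using this

lemma pot_union {W : Type*} [DecidableEq W] (G : SimpleGraph W) (I F : Set W) {X Y : Finset W}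
    (h : Disjoint X Y) :
    pot G I F (X ∪ Y) = pot G I F X + pot G I F Y - 4 * E2 G X Y := by
  unfold pot
  rw [E2_union G h, Finset.sum_union h]; ring

lemma E2_even {W : Type*} (G : SimpleGraph W) (X : Finset W) : ∃ k : ℤ, E2 G X X = 2 * k := by
  classical
  have h3 := E2_map G (Function.Embedding.subtype (· ∈ X)) Finset.univ Finset.univ
  have h4 : (Finset.univ : Finset X).map (Function.Embedding.subtype (· ∈ X)) = X := by
    ext; simp
  rw [h4, ← two_edgeCount] at h3
  exact ⟨_, h3.symm⟩

/-- The contracted graph: the vertices of `P b` are represented by `inr b`. -/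
def starG {V : Type*} (G : SimpleGraph V) (P : Bool → Finset V) : SimpleGraph (V ⊕ Bool) where
  Adj p q := match p, q with
    | Sum.inl x, Sum.inl y => G.Adj x y
    | Sum.inl x, Sum.inr b => ∃ h ∈ P b, G.Adj x h
    | Sum.inr b, Sum.inl x => ∃ h ∈ P b, G.Adj x h
    | Sum.inr b, Sum.inr c => b ≠ c
  symm := ⟨by
    rintro (x | b) (y | c) h
    · exact G.adj_symm h
    · exact h
    · exact h
    · exact Ne.symm h⟩
  loopless := ⟨by
    rintro (x | b) h
    · exact G.loopless.irrefl x h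
    · exact h rfl⟩

lemma starG_ll {V : Type*} (G : SimpleGraph V) (P : Bool → Finset V) (x y : V) :
    (starG G P).Adj (Sum.inl x) (Sum.inl y) ↔ G.Adj x y := Iff.rfl
lemma starG_lr {V : Type*} (G : SimpleGraph V) (P : Bool → Finset V) (x : V) (b : Bool) :
    (starG G P).Adj (Sum.inl x) (Sum.inr b) ↔ ∃ h ∈ P b, G.Adj x h := Iff.rfl
lemma starG_rl {V : Type*} (G : SimpleGraph V) (P : Bool → Finset V) (x : V) (b : Bool) :
    (starG G P).Adj (Sum.inr b) (Sum.inl x) ↔ ∃ h ∈ P b, G.Adj x h := Iff.rfl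
lemma starG_rr {V : Type*} (G : SimpleGraph V) (P : Bool → Finset V) (b c : Bool) :
    (starG G P).Adj (Sum.inr b) (Sum.inr c) ↔ b ≠ c := Iff.rfl

lemma E2_starG {V : Type*} (G : SimpleGraph V) (P : Bool → Finset V) (T : Finset V)
    (R : Finset Bool)
    (hone : ∀ y ∈ T, ∀ b, ∀ h ∈ P b, ∀ h' ∈ P b, G.Adj y h → G.Adj y h' → h = h') :
    E2 (starG G P) (T.disjSum R) (T.disjSum R) =
      E2 G T T + 2 * ∑ b ∈ R, E2 G T (P b) + ∑ b ∈ R, ∑ c ∈ R, if b ≠ c then 1 else 0 := by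
  classical
  have key : ∀ y ∈ T, ∀ b, (if ∃ h ∈ P b, G.Adj y h then (1 : ℤ) else 0) =
      ∑ h ∈ P b, if G.Adj y h then 1 else 0 := by
    intro y hy b
    by_cases hex : ∃ h ∈ P b, G.Adj y h
    · rw [if_pos hex]
      obtain ⟨h, hh, hadj⟩ := hex
      rw [Finset.sum_eq_single h]
      · rw [if_pos hadj]
      · intro h' hh' hne
        rw [if_neg]
        intro hadj'
        exact hne (hone y hy b h' hh' h hh hadj' hadj)
      · intro hn; exact absurd hh hn
    · rw [if_neg hex]
      symm
      refine Finset.sum_eq_zero fun h hh => ?_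
      rw [if_neg]
      intro hadj; exact hex ⟨h, hh, hadj⟩
  have h1 : ∑ b ∈ R, E2 G T (P b) =
      ∑ y ∈ T, ∑ b ∈ R, (if ∃ h ∈ P b, G.Adj y h then (1 : ℤ) else 0) := by
    rw [Finset.sum_comm]
    refine Finset.sum_congr rfl fun b _ => ?_
    unfold E2
    refine Finset.sum_congr rfl fun y hy => ?_
    rw [key y hy b]
  have h2 := h1
  rw [Finset.sum_comm] at h2
  unfold E2 at h1 h2 ⊢
  rw [Finset.sum_disjSum]
  simp only [Finset.sum_disjSum, starG_ll, starG_lr, starG_rl, starG_rr]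
  rw [Finset.sum_add_distrib, Finset.sum_add_distrib]
  rw [← h1, ← h2]
  have h3 : ∀ s t : ℤ, s = t → ∀ a b c : ℤ, a + b + (c + s) = a + b + (c + t) := by
    rintro s t rfl _ _ _; rfl
  have h4 : (∑ b ∈ R, ∑ c ∈ R, if b ≠ c then (1 : ℤ) else 0) =
      ∑ b ∈ R, ∑ c ∈ R, @ite _ (b ≠ c) (Classical.propDecidable _) 1 0 := by
    refine Finset.sum_congr rfl fun b _ => Finset.sum_congr rfl fun c _ => ?_
    congr
  rw [h4]
  ring

set_option maxHeartbeats 1000000 in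
lemma gap {V : Type*} [Fintype V] {G : SimpleGraph V} {I F U : Set V}
    (hmin : IsMinCounterexample G I F U) (z : V) (hz : z ∈ U) (S : Finset V) (hzS : z ∈ S)
    (v : V) (hv : v ∉ S) : 2 ≤ pot G I F S := by
  classical
  by_contra hlt
  have hpp := fun X hX => pot_pos hmin.1 X hX
  obtain ⟨hass, -, -⟩ := hmin.1.1 |> fun h => (⟨h, trivial, trivial⟩ : _ ∧ True ∧ True)
  obtain ⟨-, hIF, hIU, hFU⟩ := hass
  rw [Set.disjoint_right] at hIU hFU
  have hS1 : pot G I F S = 1 := by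
    have := hpp S ⟨z, hzS⟩
    omega
  have hwz : wt I F z = 5 := by
    unfold wt; rw [if_neg (hIU hz), if_neg (hFU hz)]
  have hw1 : ∀ x, 1 ≤ wt I F x ∧ wt I F x ≤ 5 := by
    intro x; unfold wt; split_ifs <;> norm_num
  have hsum : ∑ x ∈ S, wt I F x = 1 + 2 * E2 G S S := by
    unfold pot at hS1; linarith
  have hsum2 : (S.card : ℤ) + 4 ≤ ∑ x ∈ S, wt I F x := by
    rw [← Finset.add_sum_erase S _ hzS, hwz]
    have h1 : ((S.erase z).card : ℤ) ≤ ∑ x ∈ S.erase z, wt I F x := by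
      have := Finset.sum_le_sum (s := S.erase z) (f := fun _ => (1 : ℤ)) (g := wt I F)
        fun x _ => (hw1 x).1
      simpa using this
    have h2 := Finset.card_erase_add_one hzS
    have h3 : (S.card : ℤ) = (S.erase z).card + 1 := by exact_mod_cast h2.symm
    linarith
  have hcard : 2 ≤ S.card := by
    by_contra hc
    have h1 : S = {z} := by
      have hc1 : S.card ≤ 1 := by omega
      ext y
      rw [Finset.mem_singleton]
      exact ⟨fun hy => Finset.card_le_one.1 hc1 y hy z hzS, fun hy => hy ▸ hzS⟩
    rw [h1, E2_self_singleton] at hsum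
    simp [hwz] at hsum
  have hcard' : (2 : ℤ) ≤ S.card := by exact_mod_cast hcard
  have hone : ∀ y ∉ S, ∀ h ∈ S, ∀ h' ∈ S, G.Adj y h → G.Adj y h' → h = h' := by
    intro y hy h hh h' hh' ha ha'
    by_contra hne
    have hd : Disjoint S {y} := by simpa using hy
    have h1 := hpp (S ∪ {y}) ⟨z, by simp [hzS]⟩
    rw [pot_union G I F hd, hS1] at h1
    have h2 : pot G I F {y} ≤ 5 := by
      unfold pot; rw [E2_self_singleton]; simpa using (hw1 y).2
    have h3 : 2 ≤ E2 G S {y} := by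
      rw [E2_comm]
      unfold E2
      rw [Finset.sum_singleton]
      have : ({h, h'} : Finset V) ⊆ S := by
        intro x; simp only [Finset.mem_insert, Finset.mem_singleton]
        rintro (rfl | rfl) <;> assumption
      refine le_trans ?_ (Finset.sum_le_sum_of_subset_of_nonneg this ?_)
      · rw [Finset.sum_pair hne]; simp [ha, ha']
      · intro i _ _; split_ifs <;> norm_num
    linarith
  have hcompl : Disjoint Sᶜ S := disjoint_compl_left
  have htot : E2 G Finset.univ Finset.univ = E2 G Sᶜ Sᶜ + 2 * E2 G Sᶜ S + E2 G S S := by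
    rw [← E2_union G hcompl]
    rw [show Sᶜ ∪ S = Finset.univ by rw [Finset.union_comm]; exact Finset.union_compl S]
  have hcV : (Fintype.card V : ℤ) = Sᶜ.card + S.card := by
    have := Finset.card_compl_add_card S
    exact_mod_cast this.symm
  have hcp : (1 : ℤ) ≤ Sᶜ.card := by
    have : 0 < Sᶜ.card := Finset.card_pos.2 ⟨v, by simpa using hv⟩
    exact_mod_cast this
  obtain ⟨A, B, hAB, hdis, hIA, hFB, h2i, hfor⟩ := exists_good hmin G I F hIF S
    (fun X _ hX => hpp X hX) (by
      have := E2_nonneg G Sᶜ Sᶜ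
      have := E2_nonneg G Sᶜ S
      linarith)
  have hdAB : Disjoint A B := Finset.disjoint_left.2 hdis
  have hSAB : S = A ∪ B := by ext x; simpa using hAB x
  have hAS : ∀ x ∈ A, x ∈ S := fun x hx => (hAB x).2 (Or.inl hx)
  have hBS : ∀ x ∈ B, x ∈ S := fun x hx => (hAB x).2 (Or.inr hx)
  let P : Bool → Finset V := fun b => if b then A else B
  have hPS : ∀ b, ∀ x ∈ P b, x ∈ S := by
    intro b x hx
    cases b
    · exact hBS x hx
    · exact hAS x hx
  have hE := fun (T : Finset V) (hT : ∀ y ∈ T, y ∉ S) (R : Finset Bool) =>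
    E2_starG G P T R (fun y hy b h hh h' hh' =>
      hone y (hT y hy) h (hPS b h hh) h' (hPS b h' hh'))
  let J : Set (V ⊕ Bool) := fun p => match p with
    | Sum.inl x => x ∈ I
    | Sum.inr b => b = true
  let L : Set (V ⊕ Bool) := fun p => match p with
    | Sum.inl x => x ∈ F
    | Sum.inr b => b = false
  have hJL : Disjoint J L := by
    rw [Set.disjoint_left] at hIF ⊢
    rintro (x | b) h1 h2
    · exact hIF h1 h2
    · have h1' : b = true := h1
      have h2' : b = false := h2
      simp_all
  have hwl : ∀ x, wt J L (Sum.inl x) = wt I F x := fun x => rfl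
  have hwt : wt J L (Sum.inr true) = 1 := if_pos rfl
  have hwf : wt J L (Sum.inr false) = 4 := by
    unfold wt
    rw [if_neg, if_pos]
    · exact (rfl : false = false)
    · intro h
      have h' : false = true := h
      exact absurd h' (by simp)
  have hpT : ∀ T : Finset V, (∀ y ∈ T, y ∉ S) →
      0 < pot G I F T + 1 - 4 * (E2 G T A + E2 G T B) := by
    intro T hT
    have hd : Disjoint T S := Finset.disjoint_left.2 hT
    have h1 := hpp (T ∪ S) ⟨z, by simp [hzS]⟩
    rw [pot_union G I F hd, hS1] at h1
    rw [hSAB, E2_union_right G hdAB] at h1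
    exact h1
  have hR : ∀ R : Finset Bool, R = ∅ ∨ R = {true} ∨ R = {false} ∨ R = {true, false} := by decide
  obtain ⟨A', B', hAB', hdis', hIA', hFB', h2i', hfor'⟩ := exists_good hmin (starG G P) J L hJL
    (Sᶜ.disjSum {true, false}) (by
      intro X hX hne
      rw [← Finset.toLeft_disjSum_toRight (u := X)] at hX hne ⊢
      generalize X.toLeft = T at *
      generalize X.toRight = R at *
      have hT : ∀ y ∈ T, y ∉ S := by
        intro y hy
        have := hX (Finset.inl_mem_disjSum.2 hy)
        simpa using this
      have hp := hpT T hT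
      have eA := E2_nonneg G T A
      have eB := E2_nonneg G T B
      unfold pot
      rw [hE T hT R, Finset.sum_disjSum]
      simp only [hwl]
      unfold pot at hp
      rcases hR R with rfl | rfl | rfl | rfl
      · have hTn : T.Nonempty := by
          obtain ⟨x | x, hx⟩ := hne
          · exact ⟨x, by simpa using hx⟩
          · simp at hx
        have := hpp T hTn
        unfold pot at this
        simpa using this
      · simp [hwt, P]; linarith
      · simp [hwf, P]; linarith
      · simp [hwt, hwf, P]; linarith) (by
      rw [hE Sᶜ (by simp) _, htot, hcV, Finset.card_disjSum]
      have : E2 G Sᶜ S = E2 G Sᶜ A + E2 G Sᶜ B := by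
        conv_lhs => rw [show E2 G Sᶜ S = E2 G Sᶜ (A ∪ B) by rw [← hSAB]]
        exact E2_union_right G hdAB _
      rw [this]
      simp [P]
      linarith)
  have hmemS' : ∀ x, x ∉ S → Sum.inl x ∈ Sᶜ.disjSum {true, false} := by
    intro x hx; simpa using hx
  have hmemR : ∀ b, (Sum.inr b : V ⊕ Bool) ∈ Sᶜ.disjSum {true, false} := by
    intro b; cases b <;> simp
  have htA : Sum.inr true ∈ A' := hIA' _ (hmemR true) rfl
  have hfB : Sum.inr false ∈ B' := hFB' _ (hmemR false) rfl
  have hq1 : ∀ x, Sum.inl x ∈ A' → ∀ h ∈ S, ¬ G.Adj x h := by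
    intro x hx h hh hadj
    have h1 := h2i' _ hx _ htA (by simp)
    rcases (hAB h).1 hh with hA | hB
    · exact h1.1 ((starG_lr G P x true).2 ⟨h, hA, hadj⟩)
    · exact h1.2 _ (hmemR false) ⟨(starG_lr G P x false).2 ⟨h, hB, hadj⟩,
        (starG_rr G P false true).2 (by simp)⟩
  have hq2 : ∀ x, Sum.inl x ∈ A' → ∀ h ∈ A, ∀ w, w ∉ S → ¬ (G.Adj x w ∧ G.Adj w h) := by
    rintro x hx h hh w hw ⟨h1, h2⟩
    exact (h2i' _ hx _ htA (by simp)).2 _ (hmemS' w hw)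
      ⟨h1, (starG_lr G P w true).2 ⟨h, hh, h2⟩⟩
  apply no_good hmin.1 (Finset.univ.filter fun x => x ∈ A ∨ (x ∉ S ∧ Sum.inl x ∈ A'))
    (Finset.univ.filter fun x => x ∈ B ∨ (x ∉ S ∧ Sum.inl x ∈ B'))
  refine ⟨?_, ?_, ?_, ?_, ?_, ?_⟩
  · intro x
    simp only [Finset.mem_univ, Finset.mem_filter, true_and, true_iff]
    by_cases hxS : x ∈ S
    · rcases (hAB x).1 hxS with h | h
      · exact Or.inl (Or.inl h)
      · exact Or.inr (Or.inl h)
    · rcases (hAB' _).1 (hmemS' x hxS) with h | h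
      · exact Or.inl (Or.inr ⟨hxS, h⟩)
      · exact Or.inr (Or.inr ⟨hxS, h⟩)
  · intro x
    simp only [Finset.mem_univ, Finset.mem_filter, true_and]
    rintro (h | ⟨h, h'⟩) (k | ⟨k, k'⟩)
    · exact hdis x h k
    · exact k (hAS x h)
    · exact h (hBS x k)
    · exact hdis' _ h' k'
  · intro x _ hx
    simp only [Finset.mem_univ, Finset.mem_filter, true_and]
    by_cases hxS : x ∈ S
    · exact Or.inl (hIA x hxS hx)
    · exact Or.inr ⟨hxS, hIA' _ (hmemS' x hxS) hx⟩
  · intro x _ hx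
    simp only [Finset.mem_univ, Finset.mem_filter, true_and]
    by_cases hxS : x ∈ S
    · exact Or.inl (hFB x hxS hx)
    · exact Or.inr ⟨hxS, hFB' _ (hmemS' x hxS) hx⟩
  · intro x hx y hy hxy
    simp only [Finset.mem_univ, Finset.mem_filter, true_and] at hx hy
    rcases hx with hx | ⟨hxS, hx⟩ <;> rcases hy with hy | ⟨hyS, hy⟩
    · have h1 := h2i x hx y hy hxy
      refine ⟨h1.1, fun w _ => ?_⟩
      by_cases hw : w ∈ S
      · exact h1.2 w hw
      · rintro ⟨h2, h3⟩
        exact hxy (hone w hw x (hAS x hx) y (hAS y hy) h2.symm h3)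
    · refine ⟨fun h => hq1 y hy x (hAS x hx) h.symm, fun w _ => ?_⟩
      rintro ⟨h2, h3⟩
      by_cases hw : w ∈ S
      · exact hq1 y hy w hw h3.symm
      · exact hq2 y hy x hx w hw ⟨h3.symm, h2.symm⟩
    · refine ⟨fun h => hq1 x hx y (hAS y hy) h, fun w _ => ?_⟩
      rintro ⟨h2, h3⟩
      by_cases hw : w ∈ S
      · exact hq1 x hx w hw h2
      · exact hq2 x hx y hy w hw ⟨h2, h3⟩
    · have h1 := h2i' _ hx _ hy (by simpa using hxy)
      refine ⟨h1.1, fun w _ => ?_⟩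
      rintro ⟨h2, h3⟩
      by_cases hw : w ∈ S
      · exact hq1 x hx w hw h2
      · exact h1.2 _ (hmemS' w hw) ⟨h2, h3⟩
  · intro C hC hne
    have hC' : ∀ x ∈ C, x ∈ B ∨ (x ∉ S ∧ Sum.inl x ∈ B') := by
      intro x hx; simpa using hC hx
    have hd : Disjoint (C.filter (· ∉ S)) (C.filter (· ∈ S)) := by
      rw [Finset.disjoint_left]
      intro x h1 h2
      exact (Finset.mem_filter.1 h1).2 (Finset.mem_filter.1 h2).2
    have hu : C = C.filter (· ∉ S) ∪ C.filter (· ∈ S) := by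
      rw [Finset.union_comm]
      exact (Finset.filter_union_filter_not_eq (· ∈ S) C).symm
    have hc1 : C.filter (· ∈ S) ⊆ B := by
      intro x hx
      simp only [Finset.mem_filter] at hx
      rcases hC' x hx.1 with h | h
      · exact h
      · exact absurd hx.2 h.1
    have hc2 : ∀ x ∈ C.filter (· ∉ S), x ∉ S ∧ Sum.inl x ∈ B' := by
      intro x hx
      simp only [Finset.mem_filter] at hx
      rcases hC' x hx.1 with h | h
      · exact absurd (hBS x h) hx.2
      · exact h
    have hcc := congrArg Finset.card hu
    rw [Finset.card_union_of_disjoint hd] at hcc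
    have hcc' : (C.card : ℤ) = (C.filter (· ∉ S)).card + (C.filter (· ∈ S)).card := by
      exact_mod_cast hcc
    rw [hcc']
    have hEC : E2 G C C = E2 G (C.filter (· ∉ S)) (C.filter (· ∉ S)) +
        2 * E2 G (C.filter (· ∉ S)) (C.filter (· ∈ S)) +
        E2 G (C.filter (· ∈ S)) (C.filter (· ∈ S)) := by
      rw [← E2_union G hd, ← hu]
    rw [hEC]
    generalize C.filter (· ∉ S) = C2 at *
    generalize C.filter (· ∈ S) = C1 at *
    rcases C1.eq_empty_or_nonempty with rfl | hne1
    · have hne2 : C2.Nonempty := by rw [hu] at hne; simpa using hne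
      have h1 := hfor' (C2.disjSum ∅) (by
        intro p hp
        rcases p with x | b
        · exact (hc2 x (by simpa using hp)).2
        · simp at hp) (by
          obtain ⟨x, hx⟩ := hne2
          exact ⟨Sum.inl x, by simpa using hx⟩)
      rw [hE C2 (fun y hy => (hc2 y hy).1), Finset.card_disjSum] at h1
      simpa [E2] using h1
    · have h1 := hfor' (C2.disjSum {false}) (by
        intro p hp
        rcases p with x | b
        · exact (hc2 x (by simpa using hp)).2
        · have : b = false := by simpa using hp
          rw [this]; exact hfB) ⟨Sum.inr false, by simp⟩
      rw [hE C2 (fun y hy => (hc2 y hy).1), Finset.card_disjSum] at h1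
      simp [P] at h1
      have h2 := hfor C1 hc1 hne1
      have h3 : E2 G C2 C1 ≤ E2 G C2 B := by
        unfold E2
        refine Finset.sum_le_sum fun x _ => ?_
        refine Finset.sum_le_sum_of_subset_of_nonneg hc1 ?_
        intro i _ _; split_ifs <;> norm_num
      obtain ⟨k, hk⟩ := E2_even G C1
      obtain ⟨l, hl⟩ := E2_even G C2
      omega

lemma deg_two {V : Type*} [Fintype V] (G : SimpleGraph V) (u p : V) (h : deg G u = 2)
    (hp : G.Adj u p) : ∃ q, q ≠ p ∧ ∀ x, G.Adj u x ↔ (x = p ∨ x = q) := by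
  classical
  have h' : (G.neighborSet u).ncard = 2 := h
  obtain ⟨x, y, hxy, hs⟩ := Set.ncard_eq_two.1 h'
  have hm : ∀ t, G.Adj u t ↔ (t = x ∨ t = y) := by
    intro t
    have : t ∈ G.neighborSet u ↔ t ∈ ({x, y} : Set V) := by rw [hs]
    simpa using this
  rcases (hm p).1 hp with rfl | rfl
  · exact ⟨y, hxy.symm, hm⟩
  · exact ⟨x, hxy, fun t => by rw [hm t]; tauto⟩

lemma leaf_removal {V : Type*} [DecidableEq V] (G : SimpleGraph V) (X : Finset V) (x q : V)
    (hx : x ∈ X) (hq : ∀ y ∈ X, G.Adj x y → y = q)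
    (h : (X.erase x).Nonempty → E2 G (X.erase x) (X.erase x) < 2 * (X.erase x).card) :
    E2 G X X < 2 * X.card := by
  classical
  have hd : Disjoint {x} (X.erase x) := by simp
  have hX : X = {x} ∪ X.erase x := by
    rw [← Finset.insert_eq, Finset.insert_erase hx]
  have h1 : E2 G X X = 2 * E2 G {x} (X.erase x) + E2 G (X.erase x) (X.erase x) := by
    conv_lhs => rw [hX]
    rw [E2_union G hd, E2_self_singleton]; ring
  have h2 : E2 G {x} (X.erase x) ≤ 1 := by
    unfold E2
    rw [Finset.sum_singleton, Finset.sum_boole]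
    norm_cast
    rw [Finset.card_le_one]
    intro a ha b hb
    simp only [Finset.mem_filter, Finset.mem_erase] at ha hb
    rw [hq a ha.1.2 ha.2, hq b hb.1.2 hb.2]
  have h3 : (X.card : ℤ) = (X.erase x).card + 1 := by
    exact_mod_cast (Finset.card_erase_add_one hx).symm
  rcases (X.erase x).eq_empty_or_nonempty with he | hne
  · rw [h1, h3, he]
    simp [E2]
  · have := h hne
    linarith

/-- Claim 3.9: a minimal counterexample contains no 4-vertex `v` in `U` incident to three
2-threads and to a 1-thread whose bordering vertex other than `v` lies in `F ∪ U`. -/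
theorem no_four_vertex_three_two_threads_one_thread {V : Type*} [Fintype V]
    (G : SimpleGraph V) (I F U : Set V) (hmin : IsMinCounterexample G I F U) :
    ¬ ∃ v ∈ U, deg G v = 4 ∧
      ∃ a, G.Adj v a ∧
        (∃ p : List V, IsThread G I F U p ∧ p.length = 1 ∧ a ∈ p ∧ v ∉ p ∧
          ∀ w, BordersThread G p w → w ≠ v → w ∈ F ∪ U) ∧
        ∀ u, G.Adj v u → u ≠ a →
          ∃ p : List V, IsThread G I F U p ∧ p.length = 2 ∧ u ∈ p ∧ v ∉ p := by
  classical
  rintro ⟨v, hvU, -, a, hva, ⟨p, hp, hpl, hap, hvp, hbord⟩, hthr⟩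
  obtain ⟨hcover, hIF, hIU, hFU⟩ := hmin.1.1
  have hIU' := Set.disjoint_right.1 hIU
  have hFU' := Set.disjoint_right.1 hFU
  have hpp := fun X hX => pot_pos hmin.1 X hX
  obtain ⟨a', rfl⟩ := List.length_eq_one_iff.1 hpl
  have haa : a = a' := by simpa using hap
  subst haa
  obtain ⟨-, -, -, hpU, hpb⟩ := hp
  obtain ⟨haU, hadeg⟩ := hpU a (by simp)
  obtain ⟨z, hzv, haz⟩ := deg_two G a v hadeg hva.symm
  have hazadj : G.Adj a z := (haz z).2 (Or.inr rfl)
  have hza : z ≠ a := hazadj.ne'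
  have hzFU : z ∈ F ∪ U := hbord z ⟨by simpa using hza, a, by simp, hazadj⟩ hzv
  have hz3 : 3 ≤ deg G z ∨ z ∈ I ∪ F := hpb z (by simpa using hza) ⟨a, by simp, hazadj⟩
  have hznot : ¬ (z ∈ U ∧ deg G z = 2) := by
    rintro ⟨h1, h2⟩
    rcases hz3 with h | h | h
    · omega
    · exact hIU' h1 h
    · exact hFU' h1 h
  have hth : ∀ u, G.Adj v u → u ≠ a → u ∈ U ∧ deg G u = 2 ∧
      ∃ w, w ≠ v ∧ w ∈ U ∧ deg G w = 2 ∧ ∀ x, G.Adj u x ↔ (x = v ∨ x = w) := by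
    intro u hvu hua
    obtain ⟨p, ⟨-, -, hch, hpU, -⟩, hl, hup, hvp⟩ := hthr u hvu hua
    obtain ⟨s, t, rfl⟩ := List.length_eq_two.1 hl
    have hch2 : List.IsChain G.Adj [s, t] := hch
    have hst : G.Adj s t := by simpa using hch2
    obtain ⟨q, hqv, hq⟩ := deg_two G u v (hpU u hup).2 hvu.symm
    refine ⟨(hpU u hup).1, (hpU u hup).2, q, hqv, ?_⟩
    have hqm : q ∈ [s, t] := by
      simp only [List.mem_cons, List.not_mem_nil, or_false, not_or] at hup hvp ⊢
      rcases hup with rfl | rfl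
      · rcases (hq t).1 hst with h | h
        · exact absurd h.symm hvp.2
        · exact Or.inr h.symm
      · rcases (hq s).1 hst.symm with h | h
        · exact absurd h.symm hvp.1
        · exact Or.inl h.symm
    exact ⟨(hpU q hqm).1, (hpU q hqm).2, hq⟩
  let P : V → Prop := fun x => ∃ u, G.Adj v u ∧ u ≠ a ∧ G.Adj u x ∧ x ≠ v
  have hPU : ∀ x, P x → x ∈ U ∧ deg G x = 2 := by
    rintro x ⟨u, hvu, hua, hux, hxv⟩
    obtain ⟨-, -, w, hwv, hwU, hwd, hw⟩ := hth u hvu hua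
    rcases (hw x).1 hux with h | h
    · exact absurd h hxv
    · rw [h]; exact ⟨hwU, hwd⟩
  have hNU : ∀ x, G.Adj v x → x ∈ U ∧ deg G x = 2 := by
    intro x hx
    by_cases hxa : x = a
    · rw [hxa]; exact ⟨haU, hadeg⟩
    · exact ⟨(hth x hx hxa).1, (hth x hx hxa).2.1⟩
  let D : V → Prop := fun x => x = v ∨ G.Adj v x ∨ P x
  have hDU : ∀ x, D x → x ∈ U := by
    rintro x (rfl | h | h)
    · exact hvU
    · exact (hNU x h).1
    · exact (hPU x h).1
  have hzD : ¬ D z := by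
    rintro (h | h | h)
    · exact hzv h
    · exact hznot (hNU z h)
    · exact hznot (hPU z h)
  let S : Finset V := Finset.univ.filter fun x => ¬ D x
  have hS : ∀ x, x ∈ S ↔ ¬ D x := by intro x; simp [S]
  have hvS : v ∉ S := by rw [hS]; exact fun h => h (Or.inl rfl)
  have hzI : z ∉ I := by
    rcases hzFU with h | h
    · exact fun h' => Set.disjoint_left.1 hIF h' h
    · exact hIU' h
  obtain ⟨A, B, hAB, hdis, hIA, hFB, h2i, hfor⟩ := exists_good hmin G I (F ∪ {z}) (by
      rw [Set.disjoint_left] at hIF ⊢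
      rintro x hx (h | h)
      · exact hIF hx h
      · rw [Set.mem_singleton_iff.1 h] at hx; exact hzI hx) S (by
      intro X hX hne
      have hXpos := hpp X hne
      have hwo : ∀ x, x ≠ z → wt I (F ∪ {z}) x = wt I F x := by
        intro x hx; simp [wt, hx]
      by_cases hzX : z ∈ X
      · rcases hzFU with hzF | hzU
        · have : F ∪ {z} = F := by simpa using hzF
          rw [this]; exact hXpos
        · have h2 := gap hmin z hzU X hzX v (fun h => hvS (hX h))
          unfold pot at h2 ⊢
          rw [← Finset.add_sum_erase X _ hzX] at h2 ⊢
          have h3 : ∑ x ∈ X.erase z, wt I (F ∪ {z}) x = ∑ x ∈ X.erase z, wt I F x :=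
            Finset.sum_congr rfl fun x hx => hwo x (Finset.ne_of_mem_erase hx)
          have h4 : wt I (F ∪ {z}) z = 4 := by simp [wt, hzI]
          have h5 : wt I F z = 5 := by simp [wt, hzI, hFU' hzU]
          rw [h3, h4]
          rw [h5] at h2
          linarith
      · have h3 : ∑ x ∈ X, wt I (F ∪ {z}) x = ∑ x ∈ X, wt I F x :=
          Finset.sum_congr rfl fun x hx => hwo x (fun h => hzX (h ▸ hx))
        unfold pot at hXpos ⊢
        rw [h3]; exact hXpos) (by
      have hcompl : Disjoint Sᶜ S := disjoint_compl_left
      have htot : E2 G Finset.univ Finset.univ = E2 G Sᶜ Sᶜ + 2 * E2 G Sᶜ S + E2 G S S := by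
        rw [← E2_union G hcompl]
        rw [show Sᶜ ∪ S = Finset.univ by rw [Finset.union_comm]; exact Finset.union_compl S]
      have hcV : (Fintype.card V : ℤ) = Sᶜ.card + S.card := by
        have := Finset.card_compl_add_card S
        exact_mod_cast this.symm
      have hcp : (1 : ℤ) ≤ Sᶜ.card := by
        have : 0 < Sᶜ.card := Finset.card_pos.2 ⟨v, by simpa using hvS⟩
        exact_mod_cast this
      have := E2_nonneg G Sᶜ Sᶜ
      have := E2_nonneg G Sᶜ S
      linarith)
  have hzB : z ∈ B := hFB z ((hS z).2 hzD) (Or.inr rfl)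
  have hAS : ∀ x ∈ A, ¬ D x := fun x hx => (hS x).1 ((hAB x).2 (Or.inl hx))
  have hBS : ∀ x ∈ B, ¬ D x := fun x hx => (hS x).1 ((hAB x).2 (Or.inr hx))
  have hzA : z ∉ A := fun h => hdis z h hzB
  have hq : ∀ x ∈ A, ¬ G.Adj v x ∧ ∀ w, ¬ (G.Adj v w ∧ G.Adj w x) := by
    intro x hx
    refine ⟨fun h => hAS x hx (Or.inr (Or.inl h)), ?_⟩
    rintro w ⟨h1, h2⟩
    have hxv : x ≠ v := fun h => hAS x hx (Or.inl h)
    by_cases hwa : w = a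
    · rw [hwa] at h2
      rcases (haz x).1 h2 with h | h
      · exact hxv h
      · exact hzA (h ▸ hx)
    · exact hAS x hx (Or.inr (Or.inr ⟨w, h1, hwa, h2, hxv⟩))
  apply no_good hmin.1 (Finset.univ.filter fun x => x ∈ A ∨ x = v)
    (Finset.univ.filter fun x => x ∈ B ∨ (D x ∧ x ≠ v))
  refine ⟨?_, ?_, ?_, ?_, ?_, ?_⟩
  · intro x
    simp only [Finset.mem_univ, Finset.mem_filter, true_and, true_iff]
    by_cases hD : D x
    · by_cases hxv : x = v
      · exact Or.inl (Or.inr hxv)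
      · exact Or.inr (Or.inr ⟨hD, hxv⟩)
    · rcases (hAB x).1 ((hS x).2 hD) with h | h
      · exact Or.inl (Or.inl h)
      · exact Or.inr (Or.inl h)
  · intro x
    simp only [Finset.mem_univ, Finset.mem_filter, true_and]
    rintro (h | h) (k | ⟨k, k'⟩)
    · exact hdis x h k
    · exact hAS x h k
    · exact hBS x k (Or.inl h)
    · exact k' h
  · intro x _ hx
    simp only [Finset.mem_univ, Finset.mem_filter, true_and]
    exact Or.inl (hIA x ((hS x).2 fun h => hIU' (hDU x h) hx) hx)
  · intro x _ hx
    simp only [Finset.mem_univ, Finset.mem_filter, true_and]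
    exact Or.inl (hFB x ((hS x).2 fun h => hFU' (hDU x h) hx) (Or.inl hx))
  · intro x hx y hy hxy
    simp only [Finset.mem_univ, Finset.mem_filter, true_and] at hx hy
    rcases hx with hx | rfl <;> rcases hy with hy | rfl
    · have h1 := h2i x hx y hy hxy
      refine ⟨h1.1, fun w _ => ?_⟩
      rintro ⟨h2, h3⟩
      by_cases hw : D w
      · rcases hw with rfl | hw | hw
        · exact (hq x hx).1 h2.symm
        · exact (hq x hx).2 w ⟨hw, h2.symm⟩
        · have hwd := (hPU w hw).2
          obtain ⟨u, hvu, hua, huw, hwv⟩ := hw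
          obtain ⟨q, -, hq'⟩ := deg_two G w u hwd huw.symm
          have hxq : x = q := ((hq' x).1 h2.symm).resolve_left
            fun h => hAS x hx (Or.inr (Or.inl (h ▸ hvu)))
          have hyq : y = q := ((hq' y).1 h3).resolve_left
            fun h => hAS y hy (Or.inr (Or.inl (h ▸ hvu)))
          exact hxy (hxq.trans hyq.symm)
      · exact h1.2 w ((hS w).2 hw) ⟨h2, h3⟩
    · exact ⟨fun h => (hq x hx).1 h.symm, fun w _ h => (hq x hx).2 w ⟨h.2.symm, h.1.symm⟩⟩
    · exact ⟨(hq y hy).1, fun w _ => (hq y hy).2 w⟩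
    · exact absurd rfl hxy
  · intro C
    induction C using Finset.strongInduction with
    | H C ih =>
    intro hC hne
    have hC' : ∀ x ∈ C, x ∈ B ∨ (D x ∧ x ≠ v) := by
      intro x hx; simpa using hC hx
    have hvC : v ∉ C := by
      intro h
      rcases hC' v h with h | h
      · exact hBS v h (Or.inl rfl)
      · exact h.2 rfl
    by_cases h1 : ∃ u ∈ C, G.Adj v u
    · obtain ⟨u, huC, hvu⟩ := h1
      obtain ⟨q, -, hq'⟩ := deg_two G u v (hNU u hvu).2 hvu.symm
      refine leaf_removal G C u q huC ?_ (ih _ (Finset.erase_ssubset huC)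
        ((Finset.erase_subset _ _).trans hC))
      intro y hy huy
      exact ((hq' y).1 huy).resolve_left fun h => hvC (h ▸ hy)
    · by_cases h2 : ∃ w ∈ C, P w
      · obtain ⟨w, hwC, hw⟩ := h2
        have hwd := (hPU w hw).2
        obtain ⟨u, hvu, hua, huw, hwv⟩ := hw
        obtain ⟨q, -, hq'⟩ := deg_two G w u hwd huw.symm
        refine leaf_removal G C w q hwC ?_ (ih _ (Finset.erase_ssubset hwC)
          ((Finset.erase_subset _ _).trans hC))
        intro y hy hwy
        exact ((hq' y).1 hwy).resolve_left fun h => h1 ⟨u, h ▸ hy, hvu⟩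
      · refine hfor C ?_ hne
        intro x hx
        rcases hC' x hx with h | ⟨h | h | h, h'⟩
        · exact h
        · exact absurd h h'
        · exact absurd ⟨x, hx, h⟩ h1
        · exact absurd ⟨x, hx, h⟩ h2
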